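/- arXiv:1212.6360 — 2 statements merged into one kernel-verified Lean document; each statement's English description precedes it below -/
import Mathlib

section
/- Trapezoidal rule error bound for Banach-space-valued functions: let f : ℝ → E be twice continuously differentiable on [a, b] with ‖f″(s)‖ ≤ M for all s ∈ [a, b]. Then ‖∫_a^b f(s) ds − ((b−a)/2)·(f(a) + f(b))‖ ≤ M·(b−a)³/12. -/
open MeasureTheory Set

/-- Green's representation of the trapezoidal error: the kernel `(s - a) * (b - s) / 2` integrated
against the second derivative. -/
theorem integral_sub_trapezoid_eq_neg_integral_smul {E : Type*} [NormedAddCommGroup E]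
    [NormedSpace ℝ E] [CompleteSpace E] {f f' f'' : ℝ → E} {a b : ℝ} (hab : a ≤ b)
    (hf : ContinuousOn f (Icc a b)) (hf' : ContinuousOn f' (Icc a b))
    (hf'' : ContinuousOn f'' (Icc a b))
    (hd : ∀ s ∈ Ioo a b, HasDerivAt f (f' s) s) (hd' : ∀ s ∈ Ioo a b, HasDerivAt f' (f'' s) s) :
    (∫ s in a..b, f s) - ((b - a) / 2) • (f a + f b) =
      -∫ s in a..b, ((s - a) * (b - s) / 2) • f'' s := by
  have hk : ContinuousOn (fun s : ℝ ↦ ((s - a) * (b - s) / 2) • f'' s) (Icc a b) :=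
    (by fun_prop : Continuous fun s : ℝ ↦ (s - a) * (b - s) / 2).continuousOn.smul hf''
  have hki := hk.intervalIntegrable_of_Icc (μ := volume) hab
  have hfi := hf.intervalIntegrable_of_Icc (μ := volume) hab
  have key := intervalIntegral.integral_eq_sub_of_hasDerivAt_of_le hab
    (f := fun s ↦ ((s - a) * (b - s) / 2) • f' s - ((a + b) / 2 - s) • f s)
    (f' := fun s ↦ ((s - a) * (b - s) / 2) • f'' s + f s)
    (((by fun_prop : Continuous fun s : ℝ ↦ (s - a) * (b - s) / 2).continuousOn.smul hf').sub
      ((by fun_prop : Continuous fun s : ℝ ↦ (a + b) / 2 - s).continuousOn.smul hf))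
    (fun s hs ↦ by
      have h₁ : HasDerivAt (fun s : ℝ ↦ (s - a) * (b - s) / 2) ((a + b) / 2 - s) s := by
        refine ((((hasDerivAt_id s).sub_const a).mul
          ((hasDerivAt_id s).const_sub b)).div_const 2).congr_deriv ?_
        simp only [id]
        ring
      have h₂ : HasDerivAt (fun s : ℝ ↦ (a + b) / 2 - s) (-1) s :=
        (hasDerivAt_id s).const_sub _
      refine ((h₁.smul (hd' s hs)).sub (h₂.smul (hd s hs))).congr_deriv ?_
      module)
    (hki.add hfi)
  rw [intervalIntegral.integral_add hki hfi] at key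
  rw [eq_sub_of_add_eq' key]
  module

theorem integral_sub_mul_sub_div_two (a b : ℝ) :
    ∫ s in a..b, (s - a) * (b - s) / 2 = (b - a) ^ 3 / 12 := by
  have h (s : ℝ) : HasDerivAt (fun s : ℝ ↦ (b - a) * (s - a) ^ 2 / 4 - (s - a) ^ 3 / 6)
      ((s - a) * (b - s) / 2) s := by
    have h₀ := (hasDerivAt_id s).sub_const a
    refine ((((h₀.pow 2).const_mul (b - a)).div_const 4).sub
      ((h₀.pow 3).div_const 6)).congr_deriv ?_
    simp only [id]
    push_cast
    ring
  rw [intervalIntegral.integral_eq_sub_of_hasDerivAt (fun s _ ↦ h s)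
    (Continuous.intervalIntegrable (by fun_prop) _ _)]
  ring

theorem trapezoidal_rule_error_bound
    {E : Type*} [NormedAddCommGroup E] [NormedSpace ℝ E] [CompleteSpace E]
    (f : ℝ → E) (a b M : ℝ) (hab : a ≤ b)
    (hf : ContDiffOn ℝ 2 f (Set.Icc a b))
    (hM : ∀ s ∈ Set.Icc a b, ‖iteratedDerivWithin 2 f (Set.Icc a b) s‖ ≤ M) :
    ‖(∫ s in a..b, f s) - ((b - a) / 2) • (f a + f b)‖ ≤ M * (b - a) ^ 3 / 12 := by
  rcases hab.eq_or_lt with rfl | hlt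
  · simp
  have hu := uniqueDiffOn_Icc hlt
  have hderiv (n : ℕ) (hn : n < 2) (s : ℝ) (hs : s ∈ Ioo a b) :
      HasDerivAt (iteratedDerivWithin n f (Icc a b))
        (iteratedDerivWithin (n + 1) f (Icc a b) s) s := by
    rw [iteratedDerivWithin_succ]
    exact (hf.differentiableOn_iteratedDerivWithin (by exact_mod_cast hn) hu s
      (Ioo_subset_Icc_self hs)).hasDerivWithinAt.hasDerivAt (Icc_mem_nhds hs.1 hs.2)
  have hd : ∀ s ∈ Ioo a b, HasDerivAt f (iteratedDerivWithin 1 f (Icc a b) s) s := by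
    simpa [iteratedDerivWithin_zero] using hderiv 0 two_pos
  rw [integral_sub_trapezoid_eq_neg_integral_smul hab hf.continuousOn
    (hf.continuousOn_iteratedDerivWithin (by norm_num) hu)
    (hf.continuousOn_iteratedDerivWithin le_rfl hu) hd (hderiv 1 one_lt_two), norm_neg]
  calc
    _ ≤ ∫ s in a..b, (s - a) * (b - s) / 2 * M := by
      refine intervalIntegral.norm_integral_le_of_norm_le hab (.of_forall fun s hs ↦ ?_)
        (Continuous.intervalIntegrable (by fun_prop) _ _)
      have h₀ : 0 ≤ (s - a) * (b - s) / 2 :=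
        div_nonneg (mul_nonneg (sub_nonneg.2 hs.1.le) (sub_nonneg.2 hs.2)) zero_le_two
      rw [norm_smul, Real.norm_of_nonneg h₀]
      exact mul_le_mul_of_nonneg_left (hM s (Ioc_subset_Icc_self hs)) h₀
    _ = M * (b - a) ^ 3 / 12 := by
      rw [intervalIntegral.integral_mul_const, integral_sub_mul_sub_div_two]
      ring
end

section
/- The Rodrigues polynomial R_n is orthogonal on [−1, 1] to all polynomials of lower degree: for every natural number n and every real polynomial p with deg p < n, ∫_{−1}^{1} R_n(x)·p(x) dx = 0, where R_n(x) is the n-th derivative of (x² − 1)^n. -/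
open Polynomial

/-- The numerator of the Rodrigues formula: the `n`-th derivative of `(X² - 1)^n`. -/
noncomputable def rodrigues (n : ℕ) : Polynomial ℝ :=
  derivative^[n] ((X ^ 2 - 1) ^ n)

/-- Repeated integration by parts: if the first `n` derivatives of `q` vanish at both endpoints and
the `n`-th derivative of `p` is zero, then the `n`-th derivative of `q` is orthogonal to `p`. -/
theorem integral_iterate_derivative_mul_eq_zero (q : ℝ[X]) (a b : ℝ) (n : ℕ) (p : ℝ[X])
    (ha : ∀ k < n, (derivative^[k] q).eval a = 0) (hb : ∀ k < n, (derivative^[k] q).eval b = 0)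
    (hp : derivative^[n] p = 0) :
    ∫ x in a..b, (derivative^[n] q).eval x * p.eval x = 0 := by
  induction n generalizing p with
  | zero => simp_all
  | succ n ih =>
    have h := ih (derivative p) (fun k hk => ha k (by lia)) (fun k hk => hb k (by lia)) hp
    have parts := intervalIntegral.integral_mul_deriv_eq_deriv_mul (a := a) (b := b)
      (fun x _ => p.hasDerivAt x) (fun x _ => (derivative^[n] q).hasDerivAt x)
      (p.derivative.continuous.intervalIntegrable a b)
      ((derivative^[n] q).derivative.continuous.intervalIntegrable a b)
    simp_rw [Function.iterate_succ_apply', mul_comm _ (p.eval _)]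
    simp_rw [mul_comm _ ((derivative p).eval _)] at h
    rw [parts, ha n n.lt_succ_self, hb n n.lt_succ_self, h]
    simp

theorem eval_iterate_derivative_pow_eq_zero {r : ℝ[X]} {a : ℝ} (hr : r.eval a = 0) {k n : ℕ}
    (hk : k < n) : (derivative^[k] (r ^ n)).eval a = 0 := by
  refine eval_eq_zero_of_dvd_of_eval_eq_zero (pow_sub_dvd_iterate_derivative_pow r n k) ?_
  rw [eval_pow, hr, zero_pow (by lia)]

theorem rodrigues_orthogonal_to_lower_degree (n : ℕ) (p : Polynomial ℝ)
    (hp : p.degree < n) :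
    ∫ x in (-1:ℝ)..1, (rodrigues n).eval x * p.eval x = 0 :=
  integral_iterate_derivative_mul_eq_zero _ _ _ n p
    (fun _ hk => eval_iterate_derivative_pow_eq_zero (by simp) hk)
    (fun _ hk => eval_iterate_derivative_pow_eq_zero (by simp) hk)
    (iterate_derivative_eq_zero_of_degree_lt hp)
end
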